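/- arXiv:2010.01756 — 3 statements merged into one kernel-verified Lean document; each statement's English description precedes it below -/
import Mathlib

section
/- Fix r_0 > 0 and ε > 0. There exist constants γ, r > 0 such that for all sufficiently large n with n > 100r², and any starting configurations σ_0, σ̃_0 ∈ Σ_n whose proportion vectors satisfy S_0, S̃_0 ∈ S^{r_0/√n}, there is a Markovian coupling of the two cyclic dynamics (with p = 1/2) under which, letting T_1 = min{t : ‖S_t − S̃_t‖_1 < 10/n}, one has ℙ( T_1 < γn and max(‖S_t − ē‖_2, ‖S̃_t − ē‖_2) < r/√n for all t ≤ T_1 ) ≥ 1 − ε. -/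
open Finset
open scoped Classical

/-- Configuration space `Σ_n = {1,2,3}^{V_n}`, colors encoded as `Fin 3`. -/
abbrev Config (n : ℕ) := Fin n → Fin 3

/-- Transition matrix of the cyclic dynamics with parameter `p` on `Σ_n`. -/
noncomputable def cyclicP (n : ℕ) (p : ℝ) : Matrix (Config n) (Config n) ℝ :=
  Matrix.of fun σ τ => (1 / (n : ℝ)) * ∑ v : Fin n,
    ((1 - p) * (if τ = σ then (1 : ℝ) else 0)
      + p * (if τ = Function.update σ v (σ v + 1) then (1 : ℝ) else 0))

/-- Proportion vector `S(σ) ∈ ℝ³`. -/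
noncomputable def propVec {n : ℕ} (σ : Config n) : Fin 3 → ℝ :=
  fun k => ((univ.filter fun v => σ v = k).card : ℝ) / n

/-- ℓ¹ norm on `ℝ³`. -/
def l1 (x : Fin 3 → ℝ) : ℝ := ∑ k, |x k|

/-- Euclidean norm on `ℝ³`. -/
noncomputable def l2 (x : Fin 3 → ℝ) : ℝ := Real.sqrt (∑ k, (x k) ^ 2)

/-- Membership in `S^ρ = {s ∈ S : ‖s − ē‖_∞ < ρ}`, where `S` is the probability
simplex in `ℝ³` and `ē = (1/3,1/3,1/3)`. -/
def inS (ρ : ℝ) (s : Fin 3 → ℝ) : Prop :=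
  (∀ k, 0 ≤ s k) ∧ (∑ k, s k) = 1 ∧ (∀ k, |s k - 1/3| < ρ)

/-- A Markovian coupling of two copies of the cyclic dynamics: a transition matrix on
`Σ_n × Σ_n` with nonnegative entries whose marginal transitions are both `cyclicP n p`. -/
def IsCoupling (n : ℕ) (p : ℝ) (K : Matrix (Config n × Config n) (Config n × Config n) ℝ) : Prop :=
  (∀ x y, 0 ≤ K x y) ∧
  (∀ x : Config n × Config n, ∀ τ : Config n,
      ∑ τ' : Config n, K x (τ, τ') = cyclicP n p x.1 τ) ∧
  (∀ x : Config n × Config n, ∀ τ' : Config n,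
      ∑ τ : Config n, K x (τ, τ') = cyclicP n p x.2 τ')

/-- Probability that a Markov chain with transition matrix `K` started at `x0`
produces a length-`m` trajectory lying in the path event `E`. -/
noncomputable def pathProb {X : Type*} [Fintype X] [DecidableEq X]
    (K : Matrix X X ℝ) (x0 : X) (m : ℕ) (E : (Fin (m+1) → X) → Prop) : ℝ :=
  ∑ p : Fin (m+1) → X,
    if p 0 = x0 ∧ E p then ∏ i : Fin m, K (p i.castSucc) (p i.succ) else 0

/-- Number of vertices of colour `k`. -/
def colorCount {n : ℕ} (σ : Config n) (k : Fin 3) : ℤ :=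
  ((univ.filter fun v => σ v = k).card : ℤ)

/-- Difference of the colour counts of two configurations. -/
def countDiff {n : ℕ} (x : Config n × Config n) (k : Fin 3) : ℤ :=
  colorCount x.1 k - colorCount x.2 k

/-- The ℓ¹ distance between the colour counts of two configurations. -/
def countDist {n : ℕ} (x : Config n × Config n) : ℤ := ∑ k, |countDiff x k|

/-- Advance the colour of `v` when the coin `c` is `true`. -/
def rotateIf {n : ℕ} (c : Bool) (σ : Config n) (v : Fin n) : Config n :=
  if c then Function.update σ v (σ v + 1) else σ

lemma sum_comp_color {n : ℕ} (σ : Config n) (h : Fin 3 → ℝ) :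
    ∑ v, h (σ v) = ∑ k, (colorCount σ k : ℝ) * h k := by
  have h1 : ∀ v, h (σ v) = ∑ k, if σ v = k then h k else 0 := fun v => by simp
  simp_rw [h1]
  rw [sum_comm]
  refine sum_congr rfl fun k _ => ?_
  rw [← sum_filter, sum_const, nsmul_eq_mul]
  simp [colorCount]

lemma sum_colorCount {n : ℕ} (σ : Config n) : ∑ k, colorCount σ k = n := by
  have h := sum_comp_color σ fun _ => 1
  simp only [sum_const, card_univ, Fintype.card_fin, nsmul_eq_mul, mul_one] at h
  exact_mod_cast h.symm

lemma colorCount_eq_sum {n : ℕ} (σ : Config n) (k : Fin 3) :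
    colorCount σ k = ∑ v, if σ v = k then (1 : ℤ) else 0 := by
  simp [colorCount]

lemma colorCount_rotate {n : ℕ} (σ : Config n) (v : Fin n) (k : Fin 3) :
    colorCount (rotateIf true σ v) k =
      colorCount σ k + (if k = σ v + 1 then 1 else 0) - (if k = σ v then 1 else 0) := by
  rw [colorCount_eq_sum, colorCount_eq_sum, ← add_sum_erase _ _ (mem_univ v),
    ← add_sum_erase (a := v) univ (fun w => if σ w = k then (1 : ℤ) else 0) (mem_univ v)]
  have h : ∀ w ∈ univ.erase v, (if rotateIf true σ v w = k then (1 : ℤ) else 0)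
      = if σ w = k then 1 else 0 := by
    intro w hw
    simp [rotateIf, Function.update_of_ne (ne_of_mem_erase hw)]
  rw [sum_congr rfl h]
  simp only [rotateIf, if_true, Function.update_self, eq_comm (a := k)]
  ring

/-- A bijection between the vertices that matches colours as often as possible pairs the
remaining vertices so that the first has an over-represented colour in the first configuration
and the second has an over-represented colour in the second configuration. -/
lemma exists_perm_matching {n : ℕ} (x : Config n × Config n) :
    ∃ π : Equiv.Perm (Fin n), ∀ v, x.2 (π v) = x.1 v ∨
      (0 < countDiff x (x.1 v) ∧ countDiff x (x.2 (π v)) < 0) := by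
  obtain ⟨σ, σ'⟩ := x
  simp only
  obtain ⟨π, hπ⟩ := Finite.exists_max fun π : Equiv.Perm (Fin n) =>
    (univ.filter fun v => σ' (π v) = σ v).card
  have key : ∀ v w, σ' (π v) ≠ σ v → σ' (π w) ≠ σ w → σ' (π w) ≠ σ v := by
    intro v w hv hw hvw
    have hlt : (univ.filter fun u => σ' (π u) = σ u) ⊂
        univ.filter fun u => σ' (((Equiv.swap v w).trans π) u) = σ u := by
      rw [Finset.ssubset_iff_of_subset]
      · exact ⟨v, mem_filter.mpr ⟨mem_univ _, by simp [hvw]⟩, by simp [hv]⟩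
      · intro u hu
        simp only [mem_filter, mem_univ, true_and] at hu ⊢
        have h1 : u ≠ v := by rintro rfl; exact hv hu
        have h2 : u ≠ w := by rintro rfl; exact hw hu
        simp [Equiv.swap_apply_of_ne_of_ne h1 h2, hu]
    exact absurd (hπ ((Equiv.swap v w).trans π)) (not_le.mpr (card_lt_card hlt))
  have hcard : ∀ k, (univ.filter fun w => σ' (π w) = k).card
      = (univ.filter fun w => σ' w = k).card := by
    intro k
    refine card_bij (fun w _ => π w) ?_ ?_ ?_
    · intro w hw; simpa using hw
    · intro a _ b _ h; exact π.injective h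
    · intro b hb; exact ⟨π.symm b, by simpa using hb, by simp⟩
  refine ⟨π, fun v => ?_⟩
  by_cases hv : σ' (π v) = σ v
  · exact Or.inl hv
  right
  constructor
  · by_contra hD
    simp only [countDiff, colorCount, ← hcard (σ v)] at hD
    have hsub : ¬ (univ.filter fun w => σ' (π w) = σ v) ⊆ univ.filter fun w => σ w = σ v := by
      intro hs
      have := card_lt_card ((Finset.ssubset_iff_of_subset hs).mpr ⟨v, by simp, by simp [hv]⟩)
      omega
    obtain ⟨w, hw1, hw2⟩ := Finset.not_subset.mp hsub
    simp only [mem_filter, mem_univ, true_and] at hw1 hw2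
    exact key v w hv (by rw [hw1]; exact fun h => hw2 h.symm) hw1
  · by_contra hD
    simp only [countDiff, colorCount, ← hcard (σ' (π v))] at hD
    have hsub : ¬ (univ.filter fun w => σ w = σ' (π v)) ⊆
        univ.filter fun w => σ' (π w) = σ' (π v) := by
      intro hs
      have := card_lt_card ((Finset.ssubset_iff_of_subset hs).mpr
        ⟨v, by simp, by simp [Ne.symm hv]⟩)
      omega
    obtain ⟨w, hw1, hw2⟩ := Finset.not_subset.mp hsub
    simp only [mem_filter, mem_univ, true_and] at hw1 hw2
    exact key w v (by rw [hw1]; exact hw2) hv hw1.symm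

lemma sum_countDiff {n : ℕ} (x : Config n × Config n) : ∑ k, countDiff x k = 0 := by
  simp [countDiff, sum_sub_distrib, sum_colorCount]

lemma exists_opposite_signs {n : ℕ} (x : Config n × Config n) (hx : 0 < countDist x) :
    ∃ i, countDiff x i * countDiff x (i + 1) < 0 := by
  have h := sum_countDiff x
  by_contra! hcon
  have h0 := hcon 0
  have h1 := hcon 1
  have h2 := hcon 2
  simp only [countDist, Fin.sum_univ_three] at h hx
  rw [show (0 : Fin 3) + 1 = 1 from rfl] at h0
  rw [show (1 : Fin 3) + 1 = 2 from rfl] at h1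
  rw [show (2 : Fin 3) + 1 = 0 from rfl] at h2
  generalize countDiff x 0 = a at *
  generalize countDiff x 1 = b at *
  generalize countDiff x 2 = c at *
  have hc : c = -a - b := by linarith
  subst hc
  have ha : a = 0 := by nlinarith [sq_nonneg a, sq_nonneg b, sq_nonneg (a + b)]
  have hb : b = 0 := by nlinarith [sq_nonneg a, sq_nonneg b, sq_nonneg (a + b)]
  simp [ha, hb] at hx

/-- The colour of the matched vertices that are updated with opposite coins. -/
noncomputable def noiseColor {n : ℕ} (x : Config n × Config n) : Fin 3 :=
  Classical.epsilon fun i => countDiff x i * countDiff x (i + 1) < 0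

/-- A colour-matching bijection between the vertices of the two configurations. -/
noncomputable def matching {n : ℕ} (x : Config n × Config n) : Equiv.Perm (Fin n) :=
  (exists_perm_matching x).choose

/-- Whether the coins used at `v` and at its partner are opposite. -/
noncomputable def oppositeCoins {n : ℕ} (x : Config n × Config n) (v : Fin n) : Bool :=
  decide (x.2 (matching x v) ≠ x.1 v ∨ x.1 v = noiseColor x)

/-- The pair of configurations reached from `x` when `v` is selected with coin `c`. -/
noncomputable def coupledMove {n : ℕ} (x : Config n × Config n) (v : Fin n) (c : Bool) :
    Config n × Config n :=
  (rotateIf c x.1 v, rotateIf (c ^^ oppositeCoins x v) x.2 (matching x v))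

/-- The transition matrix of the coupling. -/
noncomputable def couplingMatrix (n : ℕ) :
    Matrix (Config n × Config n) (Config n × Config n) ℝ :=
  Matrix.of fun x y => (1 / (n : ℝ)) * ∑ v, (1 / 2) * ∑ c : Bool,
    if y = coupledMove x v c then (1 : ℝ) else 0

lemma sum_couplingMatrix_mul {n : ℕ} (x : Config n × Config n) (h : Config n × Config n → ℝ) :
    ∑ y, couplingMatrix n x y * h y =
      (1 / (n : ℝ)) * ∑ v, (1 / 2) * (h (coupledMove x v true) + h (coupledMove x v false)) := by
  simp only [couplingMatrix, Matrix.of_apply, mul_assoc, ← mul_sum, sum_mul, Fintype.sum_bool]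
  rw [sum_comm]
  congr 2
  simp [add_mul, sum_add_distrib]

lemma sum_couplingMatrix_fst {n : ℕ} (x : Config n × Config n) (h : Config n → ℝ) :
    ∑ y, couplingMatrix n x y * h y.1 =
      (1 / (n : ℝ)) * ∑ v, (1 / 2) * (h (rotateIf true x.1 v) + h x.1) := by
  rw [sum_couplingMatrix_mul x fun y => h y.1]
  simp [coupledMove, rotateIf]

lemma sum_couplingMatrix_snd {n : ℕ} (x : Config n × Config n) (h : Config n → ℝ) :
    ∑ y, couplingMatrix n x y * h y.2 =
      (1 / (n : ℝ)) * ∑ v, (1 / 2) * (h (rotateIf true x.2 v) + h x.2) := by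
  rw [sum_couplingMatrix_mul x fun y => h y.2,
    ← Equiv.sum_comp (matching x) fun v => (1 / 2 : ℝ) * (h (rotateIf true x.2 v) + h x.2)]
  congr 1
  refine sum_congr rfl fun v _ => ?_
  cases hb : oppositeCoins x v <;> simp [coupledMove, rotateIf, hb, add_comm]

lemma couplingMatrix_nonneg {n : ℕ} (x y : Config n × Config n) : 0 ≤ couplingMatrix n x y := by
  simp only [couplingMatrix, Matrix.of_apply]
  positivity

lemma isCoupling_couplingMatrix (n : ℕ) : IsCoupling n (1 / 2) (couplingMatrix n) := by
  refine ⟨couplingMatrix_nonneg, fun x τ => ?_, fun x τ => ?_⟩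
  · have h := sum_couplingMatrix_fst x fun ρ => if ρ = τ then (1 : ℝ) else 0
    rw [Fintype.sum_prod_type] at h
    simp only [mul_ite, mul_one, mul_zero, sum_ite_irrel, sum_const_zero, sum_ite_eq',
      mem_univ, if_true] at h
    rw [h]
    simp only [cyclicP, Matrix.of_apply, rotateIf, if_true, eq_comm (a := τ)]
    congr 1
    refine sum_congr rfl fun v _ => ?_
    ring
  · have h := sum_couplingMatrix_snd x fun ρ => if ρ = τ then (1 : ℝ) else 0
    rw [Fintype.sum_prod_type_right] at h
    simp only [mul_ite, mul_one, mul_zero, sum_ite_irrel, sum_const_zero, sum_ite_eq',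
      mem_univ, if_true] at h
    rw [h]
    simp only [cyclicP, Matrix.of_apply, rotateIf, if_true, eq_comm (a := τ)]
    congr 1
    refine sum_congr rfl fun v _ => ?_
    ring

lemma sum_couplingMatrix {n : ℕ} (hn : 0 < n) (x : Config n × Config n) :
    ∑ y, couplingMatrix n x y = 1 := by
  have h := sum_couplingMatrix_mul x fun _ => 1
  have hn' : (n : ℝ) ≠ 0 := by positivity
  simp only [mul_one] at h
  rw [h]
  norm_num
  field_simp

/-- The squared Euclidean distance of the proportion vector to the centre, times `n`. -/
noncomputable def deviation {n : ℕ} (σ : Config n) : ℝ :=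
  (1 / (n : ℝ)) * ∑ k, ((colorCount σ k : ℝ) - n / 3) ^ 2

lemma deviation_nonneg {n : ℕ} (σ : Config n) : 0 ≤ deviation σ := by
  unfold deviation; positivity

lemma deviation_rotate {n : ℕ} (σ : Config n) (v : Fin n) :
    deviation (rotateIf true σ v) = deviation σ +
      (1 / (n : ℝ)) * (2 * colorCount σ (σ v + 1) - 2 * colorCount σ (σ v) + 2) := by
  simp only [deviation, colorCount_rotate, Fin.sum_univ_three]
  generalize σ v = i
  fin_cases i <;> simp <;> ring

lemma deviation_drift {n : ℕ} (hn : 0 < n) (σ : Config n) :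
    (1 / (n : ℝ)) * ∑ v, (1 / 2) * (deviation (rotateIf true σ v) + deviation σ)
      ≤ deviation σ + 1 / n := by
  have hn' : (0 : ℝ) < n := by positivity
  have hs : (∑ k, (colorCount σ k : ℝ)) = n := by exact_mod_cast sum_colorCount σ
  have h : ∑ v, (1 / 2) * (deviation (rotateIf true σ v) + deviation σ) =
      n * deviation σ + (1 / n) * ∑ k, (colorCount σ k : ℝ) *
        (colorCount σ (k + 1) - colorCount σ k + 1) := by
    rw [← sum_comp_color σ fun k => ((colorCount σ (k + 1) : ℝ) - colorCount σ k + 1)]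
    simp only [deviation_rotate, mul_sum]
    rw [show (n : ℝ) * deviation σ = ∑ v : Fin n, deviation σ by simp, ← sum_add_distrib]
    refine sum_congr rfl fun v _ => ?_
    ring
  have hk : ∑ k, (colorCount σ k : ℝ) * (colorCount σ (k + 1) - colorCount σ k + 1) ≤ n := by
    simp only [Fin.sum_univ_three] at hs ⊢
    rw [show (0 : Fin 3) + 1 = 1 from rfl, show (1 : Fin 3) + 1 = 2 from rfl,
      show (2 : Fin 3) + 1 = 0 from rfl]
    nlinarith [sq_nonneg ((colorCount σ 0 : ℝ) - colorCount σ 1),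
      sq_nonneg ((colorCount σ 1 : ℝ) - colorCount σ 2),
      sq_nonneg ((colorCount σ 2 : ℝ) - colorCount σ 0)]
  rw [h, mul_add, ← mul_assoc, one_div_mul_cancel hn'.ne', one_mul]
  gcongr
  calc (1 / (n : ℝ)) * ((1 / n) * _) ≤ (1 / (n : ℝ)) * ((1 / n) * n) := by gcongr
    _ = 1 / n := by field_simp

section PathProb

variable {X : Type*} [Fintype X] [DecidableEq X]

lemma pathProb_succ (K : Matrix X X ℝ) (x : X) (m : ℕ) (E : (Fin (m + 2) → X) → Prop) :
    pathProb K x (m + 1) E =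
      ∑ y, K x y * pathProb K y m fun q => E (Fin.cons x q) := by
  unfold pathProb
  rw [← (Fin.consEquiv fun _ : Fin (m + 2) => X).sum_comp, Fintype.sum_prod_type,
    sum_eq_single x]
  · simp only [mul_sum]
    rw [sum_comm]
    refine sum_congr rfl fun q _ => ?_
    rw [sum_eq_single (q 0)]
    · by_cases h : E (Fin.cons x q) <;>
        simp [Fin.consEquiv, h, Fin.prod_univ_succ]
    · intro y _ hy
      simp [Ne.symm hy]
    · simp
  · intro y _ hy
    simp [Fin.consEquiv, hy]
  · simp

lemma pathProb_nonneg {K : Matrix X X ℝ} (hK : ∀ x y, 0 ≤ K x y) (x : X) (m : ℕ)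
    (E : (Fin (m + 1) → X) → Prop) : 0 ≤ pathProb K x m E := by
  unfold pathProb
  refine sum_nonneg fun p _ => ?_
  split_ifs
  · exact prod_nonneg fun i _ => hK _ _
  · exact le_rfl

lemma pathProb_mono {K : Matrix X X ℝ} (hK : ∀ x y, 0 ≤ K x y) (x : X) (m : ℕ)
    {E E' : (Fin (m + 1) → X) → Prop} (h : ∀ p, p 0 = x → E p → E' p) :
    pathProb K x m E ≤ pathProb K x m E' := by
  unfold pathProb
  refine sum_le_sum fun p _ => ?_
  by_cases hp : p 0 = x ∧ E p
  · rw [if_pos hp, if_pos ⟨hp.1, h p hp.1 hp.2⟩]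
  · rw [if_neg hp]
    split_ifs
    · exact prod_nonneg fun i _ => hK _ _
    · exact le_rfl

lemma pathProb_true {K : Matrix X X ℝ} (hK : ∀ x, ∑ y, K x y = 1) (x : X) (m : ℕ) :
    pathProb K x m (fun _ => True) = 1 := by
  induction m generalizing x with
  | zero =>
    unfold pathProb
    rw [← (Equiv.funUnique (Fin 1) X).symm.sum_comp]
    simp
  | succ m ih => rw [pathProb_succ]; simp [ih, hK]

/-- The path enters `G` strictly before its last step and stays in `B` up to that time. -/
def HitsWithin (G B : X → Prop) (m : ℕ) (p : Fin (m + 1) → X) : Prop :=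
  ∃ u : Fin (m + 1), (u : ℕ) < m ∧ G (p u) ∧ (∀ t, t < u → ¬ G (p t)) ∧ ∀ t, t ≤ u → B (p t)

/-- A nonnegative Lyapunov function that is at least `1` outside `B` and decreases by `δ` on
average in `B \ G` bounds from below the probability of reaching `G` inside `B`. -/
lemma le_pathProb_hitsWithin {K : Matrix X X ℝ} (hK : ∀ x y, 0 ≤ K x y)
    (hK1 : ∀ x, ∑ y, K x y = 1) {G B : X → Prop} {V : X → ℝ} {δ : ℝ}
    (hV : ∀ x, 0 ≤ V x) (hB : ∀ x, ¬ B x → 1 ≤ V x)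
    (hdrift : ∀ x, B x → ¬ G x → ∑ y, K x y * V y ≤ V x - δ) (m : ℕ) (x : X) :
    min 1 (m * δ) - V x ≤ pathProb K x m (HitsWithin G B m) := by
  induction m generalizing x with
  | zero =>
    have h0 := pathProb_nonneg hK x 0 (HitsWithin G B 0)
    have := hV x
    simp only [Nat.cast_zero, zero_mul]
    linarith [min_le_right (1 : ℝ) 0]
  | succ m ih =>
    by_cases hBx : B x
    · by_cases hGx : G x
      · have h1 : pathProb K x (m + 1) (fun _ => True) ≤
            pathProb K x (m + 1) (HitsWithin G B (m + 1)) := by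
          refine pathProb_mono hK x _ fun p hp _ => ⟨0, by simp, hp ▸ hGx, by simp, ?_⟩
          intro t ht
          rw [Fin.le_zero_iff.mp ht, hp]
          exact hBx
        rw [pathProb_true hK1] at h1
        linarith [hV x, min_le_left (1 : ℝ) ((m + 1 : ℕ) * δ)]
      · rw [pathProb_succ]
        calc min 1 (((m + 1 : ℕ) : ℝ) * δ) - V x
            ≤ min 1 (m * δ) - ∑ y, K x y * V y := by
              have hd := hdrift x hBx hGx
              by_cases hδ : 0 ≤ δ
              · have : min 1 (((m + 1 : ℕ) : ℝ) * δ) ≤ min 1 (m * δ) + δ := by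
                  push_cast
                  rcases le_total 1 (m * δ) with h | h
                  · rw [min_eq_left h]
                    linarith [min_le_left (1 : ℝ) ((m + 1) * δ)]
                  · rw [min_eq_right h]
                    linarith [min_le_right (1 : ℝ) ((m + 1) * δ)]
                linarith
              · have hm : (m : ℝ) * δ ≤ 0 :=
                  mul_nonpos_of_nonneg_of_nonpos (Nat.cast_nonneg m) (not_le.mp hδ).le
                rw [min_eq_right (hm.trans zero_le_one)]
                have := min_le_right (1 : ℝ) (((m + 1 : ℕ) : ℝ) * δ)
                push_cast at this ⊢
                linarith
          _ = ∑ y, K x y * (min 1 (m * δ) - V y) := by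
              simp only [mul_sub, sum_sub_distrib, ← sum_mul, hK1, one_mul]
          _ ≤ _ := by
              refine sum_le_sum fun y _ => mul_le_mul_of_nonneg_left ((ih y).trans ?_) (hK x y)
              refine pathProb_mono hK y m fun q _ => ?_
              rintro ⟨u, hu, hGu, hlt, hle⟩
              refine ⟨u.succ, by simpa using hu, by simpa using hGu, ?_, ?_⟩
              · intro t
                refine Fin.cases (fun _ => by simpa using hGx) (fun s hs => ?_) t
                simpa using hlt s (Fin.succ_lt_succ_iff.mp hs)
              · intro t
                refine Fin.cases (fun _ => by simpa using hBx) (fun s hs => ?_) t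
                simpa using hle s (Fin.succ_le_succ_iff.mp hs)
    · linarith [hB x hBx, min_le_left (1 : ℝ) (((m + 1 : ℕ) : ℝ) * δ),
        pathProb_nonneg hK x (m + 1) (HitsWithin G B (m + 1))]

end PathProb

lemma matching_spec {n : ℕ} (x : Config n × Config n) (v : Fin n) :
    x.2 (matching x v) = x.1 v ∨
      (0 < countDiff x (x.1 v) ∧ countDiff x (x.2 (matching x v)) < 0) :=
  (exists_perm_matching x).choose_spec v

lemma noiseColor_spec {n : ℕ} (x : Config n × Config n) (hx : 0 < countDist x) :
    countDiff x (noiseColor x) * countDiff x (noiseColor x + 1) < 0 :=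
  Classical.epsilon_spec (exists_opposite_signs x hx)

lemma countDiff_rotate_fst {n : ℕ} (x : Config n × Config n) (v : Fin n) (k : Fin 3) :
    countDiff (rotateIf true x.1 v, x.2) k =
      countDiff x k + ((if k = x.1 v + 1 then 1 else 0) - (if k = x.1 v then 1 else 0)) := by
  simp only [countDiff, colorCount_rotate]; ring

lemma countDiff_rotate_snd {n : ℕ} (x : Config n × Config n) (v : Fin n) (k : Fin 3) :
    countDiff (x.1, rotateIf true x.2 v) k =
      countDiff x k - ((if k = x.2 v + 1 then 1 else 0) - (if k = x.2 v then 1 else 0)) := by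
  simp only [countDiff, colorCount_rotate]; ring

lemma sum_abs_shift_le {d : Fin 3 → ℤ} {i : Fin 3} (h : 0 < d i) :
    ∑ k, |d k + ((if k = i + 1 then 1 else 0) - (if k = i then 1 else 0))| ≤ ∑ k, |d k| := by
  simp only [Fin.sum_univ_three]
  fin_cases i <;> simp at h ⊢ <;> grind

lemma sum_abs_unshift_le {d : Fin 3 → ℤ} {i : Fin 3} (h : d i < 0) :
    ∑ k, |d k - ((if k = i + 1 then 1 else 0) - (if k = i then 1 else 0))| ≤ ∑ k, |d k| := by
  simp only [Fin.sum_univ_three]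
  fin_cases i <;> simp at h ⊢ <;> grind

lemma sum_abs_shift_of_opposite {d : Fin 3 → ℤ} {i : Fin 3} (h : d i * d (i + 1) < 0) :
    ∃ s : ℤ, (s = 2 ∨ s = -2) ∧
      ∑ k, |d k + ((if k = i + 1 then 1 else 0) - (if k = i then 1 else 0))|
        = ∑ k, |d k| + s ∧
      ∑ k, |d k - ((if k = i + 1 then 1 else 0) - (if k = i then 1 else 0))|
        = ∑ k, |d k| - s := by
  simp only [Fin.sum_univ_three]
  rcases mul_neg_iff.mp h with ⟨h1, h2⟩ | ⟨h1, h2⟩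
  · refine ⟨-2, Or.inr rfl, ?_⟩
    fin_cases i <;> simp at h1 h2 ⊢ <;> grind
  · refine ⟨2, Or.inl rfl, ?_⟩
    fin_cases i <;> simp at h1 h2 ⊢ <;> grind

lemma countDist_nonneg {n : ℕ} (x : Config n × Config n) : 0 ≤ countDist x :=
  sum_nonneg fun _ _ => abs_nonneg _

lemma countDist_move_of_unmatched {n : ℕ} {x : Config n × Config n} {v : Fin n}
    (hv : x.2 (matching x v) ≠ x.1 v) (c : Bool) :
    countDist (coupledMove x v c) ≤ countDist x := by
  obtain ⟨h1, h2⟩ := (matching_spec x v).resolve_left hv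
  have ho : oppositeCoins x v = true := by simp [oppositeCoins, hv]
  cases c
  · have : coupledMove x v false = (x.1, rotateIf true x.2 (matching x v)) := by
      simp [coupledMove, ho, rotateIf]
    simp only [this, countDist, countDiff_rotate_snd]
    exact sum_abs_unshift_le h2
  · have : coupledMove x v true = (rotateIf true x.1 v, x.2) := by
      simp [coupledMove, ho, rotateIf]
    simp only [this, countDist, countDiff_rotate_fst]
    exact sum_abs_shift_le h1

lemma countDist_move_of_matched {n : ℕ} {x : Config n × Config n} {v : Fin n}
    (hv : x.2 (matching x v) = x.1 v) (hi : x.1 v ≠ noiseColor x) (c : Bool) :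
    countDist (coupledMove x v c) = countDist x := by
  have ho : oppositeCoins x v = false := by simp [oppositeCoins, hv, hi]
  cases c
  · simp [coupledMove, ho, rotateIf]
  · have : coupledMove x v true = (rotateIf true x.1 v, rotateIf true x.2 (matching x v)) := by
      simp [coupledMove, ho]
    simp only [this, countDist, countDiff, colorCount_rotate, hv]
    refine sum_congr rfl fun k _ => ?_
    congr 1
    ring

lemma countDist_move_of_noise {n : ℕ} {x : Config n × Config n} {v : Fin n}
    (hx : 0 < countDist x) (hv : x.2 (matching x v) = x.1 v) (hi : x.1 v = noiseColor x) :
    ∃ s : ℤ, (s = 2 ∨ s = -2) ∧ countDist (coupledMove x v true) = countDist x + s ∧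
      countDist (coupledMove x v false) = countDist x - s := by
  have ho : oppositeCoins x v = true := by simp [oppositeCoins, hi]
  have h1 : coupledMove x v false = (x.1, rotateIf true x.2 (matching x v)) := by
    simp [coupledMove, ho, rotateIf]
  have h2 : coupledMove x v true = (rotateIf true x.1 v, x.2) := by
    simp [coupledMove, ho, rotateIf]
  simp only [h1, h2, countDist, countDiff_rotate_fst, countDiff_rotate_snd, hv]
  exact sum_abs_shift_of_opposite (hi ▸ noiseColor_spec x hx)

lemma min_colorCount_le_card_matched {n : ℕ} (x : Config n × Config n) (i : Fin 3) :
    min (colorCount x.1 i) (colorCount x.2 i) ≤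
      ((univ.filter fun v => x.2 (matching x v) = x.1 v ∧ x.1 v = i).card : ℤ) := by
  rcases le_or_gt (countDiff x i) 0 with hD | hD
  · refine (min_le_left _ _).trans ?_
    unfold colorCount
    gcongr with v hv
    intro hv
    refine ⟨(matching_spec x v).resolve_right fun h => ?_, hv⟩
    rw [hv] at h
    omega
  · refine (min_le_right _ _).trans ?_
    unfold colorCount
    norm_cast
    refine card_le_card_of_surjOn (matching x) fun w hw => ⟨(matching x).symm w, ?_, by simp⟩
    have hw' : x.2 w = i := by simpa using hw
    have h := (matching_spec x ((matching x).symm w)).resolve_right (by simp [hw']; omega)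
    simp only [Equiv.apply_symm_apply] at h
    simp [hw', ← h]

/-- A concave nondecreasing function of the distance, constant beyond `L`. -/
noncomputable def cappedParabola (L z : ℝ) : ℝ := min z L * (2 * L - min z L)

lemma cappedParabola_nonneg {L z : ℝ} (hL : 0 ≤ L) (hz : 0 ≤ z) : 0 ≤ cappedParabola L z :=
  mul_nonneg (le_min hz hL) (by linarith [min_le_right z L])

lemma cappedParabola_mono {L z w : ℝ} (h : z ≤ w) : cappedParabola L z ≤ cappedParabola L w := by
  have h1 : min z L ≤ min w L := min_le_min_right L h
  unfold cappedParabola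
  nlinarith [min_le_right z L, min_le_right w L]

lemma cappedParabola_le {L z : ℝ} (hL : 0 ≤ L) (hz : 0 ≤ z) : cappedParabola L z ≤ 2 * L * z := by
  unfold cappedParabola
  nlinarith [min_le_left z L, le_min hz hL]

lemma cappedParabola_add_sub {L z s : ℝ} (hs : s = 2 ∨ s = -2) (hz : z + 2 ≤ L) :
    cappedParabola L (z + s) + cappedParabola L (z - s) = 2 * cappedParabola L z - 8 := by
  unfold cappedParabola
  rw [min_eq_left (by linarith : z ≤ L)]
  rcases hs with rfl | rfl <;>
  · rw [min_eq_left (by linarith), min_eq_left (by linarith)]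
    ring

lemma cappedParabola_drift {n : ℕ} {x : Config n × Config n} {L : ℝ} (hx : 0 < countDist x)
    (hL : countDist x + 2 ≤ L) {q : ℝ} (hq : ∀ i, q * n ≤ colorCount x.1 i)
    (hq' : ∀ i, q * n ≤ colorCount x.2 i) (hn : 0 < n) :
    ∑ y, couplingMatrix n x y * cappedParabola L (countDist y) ≤
      cappedParabola L (countDist x) - 4 * q := by
  have hn' : (0 : ℝ) < n := by positivity
  rw [sum_couplingMatrix_mul x fun y => cappedParabola L (countDist y)]
  have hstep : ∀ v, (1 / 2) * (cappedParabola L (countDist (coupledMove x v true)) +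
      cappedParabola L (countDist (coupledMove x v false))) ≤ cappedParabola L (countDist x) -
        4 * if x.2 (matching x v) = x.1 v ∧ x.1 v = noiseColor x then (1 : ℝ) else 0 := by
    intro v
    by_cases hv : x.2 (matching x v) = x.1 v
    · by_cases hi : x.1 v = noiseColor x
      · obtain ⟨s, hs, h1, h2⟩ := countDist_move_of_noise hx hv hi
        have := cappedParabola_add_sub (L := L) (z := countDist x) (s := s)
          (by rcases hs with rfl | rfl <;> simp) hL
        rw [h1, h2, if_pos ⟨hv, hi⟩]
        push_cast
        linarith
      · rw [if_neg (by tauto), countDist_move_of_matched hv hi,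
          countDist_move_of_matched hv hi]
        linarith
    · have h := fun c => cappedParabola_mono (L := L)
        (Int.cast_le (R := ℝ).mpr (countDist_move_of_unmatched hv c))
      rw [if_neg (by tauto)]
      linarith [h true, h false]
  have hcard : q * n ≤ ∑ v, if x.2 (matching x v) = x.1 v ∧ x.1 v = noiseColor x
      then (1 : ℝ) else 0 := by
    have h := min_colorCount_le_card_matched x (noiseColor x)
    rw [sum_boole]
    calc q * n ≤ min (colorCount x.1 (noiseColor x) : ℝ) (colorCount x.2 (noiseColor x)) :=
          le_min (hq _) (hq' _)
      _ ≤ _ := by exact_mod_cast h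
  calc (1 / (n : ℝ)) * ∑ v, _ ≤ (1 / (n : ℝ)) * ∑ v, (cappedParabola L (countDist x) -
        4 * if x.2 (matching x v) = x.1 v ∧ x.1 v = noiseColor x then (1 : ℝ) else 0) := by
        gcongr with v
        exact hstep v
    _ ≤ (1 / (n : ℝ)) * (n * cappedParabola L (countDist x) - 4 * (q * n)) := by
        rw [sum_sub_distrib, ← mul_sum]
        gcongr
        simp
    _ = _ := by field_simp

lemma propVec_eq {n : ℕ} (σ : Config n) (k : Fin 3) : propVec σ k = colorCount σ k / n := by
  simp [propVec, colorCount]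

lemma l1_propVec_sub {n : ℕ} (x : Config n × Config n) :
    l1 (propVec x.1 - propVec x.2) = countDist x / n := by
  simp only [l1, countDist, Pi.sub_apply, propVec_eq, countDiff]
  push_cast
  rw [sum_div]
  refine sum_congr rfl fun k _ => ?_
  rw [← sub_div, abs_div, Nat.abs_cast]

lemma l2_propVec_lt_iff {n : ℕ} (hn : 0 < n) {r : ℝ} (hr : 0 < r) (σ : Config n) :
    l2 (fun k => propVec σ k - 1 / 3) < r / √n ↔ deviation σ < r ^ 2 := by
  have hn' : (0 : ℝ) < n := by positivity
  have h : ∑ k, (propVec σ k - 1 / 3) ^ 2 = deviation σ / n := by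
    simp only [deviation, propVec_eq, Fin.sum_univ_three]
    field_simp
  rw [l2, h, Real.sqrt_div (deviation_nonneg σ), div_lt_div_iff_of_pos_right (by positivity),
    Real.sqrt_lt' hr]

lemma abs_colorCount_sub_lt {n : ℕ} (hn : 0 < n) {r : ℝ} (hr : 0 < r) {σ : Config n}
    (h : deviation σ < r ^ 2) (k : Fin 3) : |(colorCount σ k : ℝ) - n / 3| < r * √n := by
  have hn' : (0 : ℝ) < n := by positivity
  refine abs_lt_of_sq_lt_sq ?_ (by positivity)
  rw [mul_pow, Real.sq_sqrt hn'.le]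
  calc ((colorCount σ k : ℝ) - n / 3) ^ 2 ≤ ∑ k, ((colorCount σ k : ℝ) - n / 3) ^ 2 :=
        single_le_sum (f := fun k => ((colorCount σ k : ℝ) - n / 3) ^ 2)
          (fun _ _ => sq_nonneg _) (mem_univ k)
    _ = deviation σ * n := by
        rw [deviation, mul_right_comm, one_div_mul_cancel hn'.ne', one_mul]
    _ < r ^ 2 * n := by gcongr

lemma countDist_le {n : ℕ} {x : Config n × Config n} {b : ℝ}
    (h : ∀ k, |(colorCount x.1 k : ℝ) - n / 3| ≤ b)
    (h' : ∀ k, |(colorCount x.2 k : ℝ) - n / 3| ≤ b) : (countDist x : ℝ) ≤ 6 * b := by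
  have hk : ∀ k, |(colorCount x.1 k : ℝ) - colorCount x.2 k| ≤ 2 * b := fun k => by
    have h1 := abs_le.mp (h k)
    have h2 := abs_le.mp (h' k)
    exact abs_le.mpr ⟨by linarith, by linarith⟩
  simp only [countDist, countDiff, Fin.sum_univ_three]
  push_cast
  linarith [hk 0, hk 1, hk 2]

lemma abs_colorCount_sub_le_of_inS {n : ℕ} (hn : 0 < n) {r : ℝ} {σ : Config n}
    (h : inS (r / √n) (propVec σ)) (k : Fin 3) :
    |(colorCount σ k : ℝ) - n / 3| ≤ r * √n := by
  have hn' : (0 : ℝ) < n := by positivity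
  have hk := (h.2.2 k).le
  have hs := Real.mul_self_sqrt hn'.le
  have : (colorCount σ k : ℝ) - n / 3 = n * (propVec σ k - 1 / 3) := by
    rw [propVec_eq]; field_simp
  rw [this, abs_mul, Nat.abs_cast]
  calc (n : ℝ) * |propVec σ k - 1 / 3| ≤ n * (r / √n) := by gcongr
    _ = (√n * √n) * (r / √n) := by rw [hs]
    _ = r * √n := by field_simp

lemma deviation_le_of_abs_le {n : ℕ} (hn : 0 < n) {r : ℝ} {σ : Config n}
    (h : ∀ k, |(colorCount σ k : ℝ) - n / 3| ≤ r * √n) : deviation σ ≤ 3 * r ^ 2 := by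
  have hn' : (0 : ℝ) < n := by positivity
  have hk : ∀ k, ((colorCount σ k : ℝ) - n / 3) ^ 2 ≤ r ^ 2 * n := fun k => by
    rw [← sq_abs, ← Real.sq_sqrt hn'.le, ← mul_pow, Real.sq_sqrt hn'.le]
    gcongr
    exact h k
  unfold deviation
  calc (1 / (n : ℝ)) * ∑ k, ((colorCount σ k : ℝ) - n / 3) ^ 2
      ≤ (1 / (n : ℝ)) * ∑ _k : Fin 3, r ^ 2 * n := by gcongr with k; exact hk k
    _ = 3 * r ^ 2 := by simp; field_simp

/-- Lyapunov function of the coupled chain. -/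
noncomputable def lyapunov (n : ℕ) (r : ℝ) (x : Config n × Config n) : ℝ :=
  (1 / r ^ 2) * deviation x.1 + (1 / r ^ 2) * deviation x.2 +
    15 / (4 * r ^ 2 * n) * cappedParabola (7 * r * √n) (countDist x)

lemma lyapunov_nonneg {n : ℕ} {r : ℝ} (hr : 0 < r) (x : Config n × Config n) :
    0 ≤ lyapunov n r x := by
  have h1 := deviation_nonneg x.1
  have h2 := deviation_nonneg x.2
  have h3 := cappedParabola_nonneg (L := 7 * r * √n) (by positivity)
    (Int.cast_nonneg (R := ℝ) (countDist_nonneg x))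
  unfold lyapunov
  positivity

lemma one_le_lyapunov {n : ℕ} {r : ℝ} (hr : 0 < r) {x : Config n × Config n}
    (h : ¬ (deviation x.1 < r ^ 2 ∧ deviation x.2 < r ^ 2)) : 1 ≤ lyapunov n r x := by
  have h1 := mul_nonneg (by positivity : 0 ≤ 1 / r ^ 2) (deviation_nonneg x.1)
  have h2 := mul_nonneg (by positivity : 0 ≤ 1 / r ^ 2) (deviation_nonneg x.2)
  have h3 := mul_nonneg (by positivity : 0 ≤ 15 / (4 * r ^ 2 * n))
    (cappedParabola_nonneg (L := 7 * r * √n) (by positivity)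
      (Int.cast_nonneg (R := ℝ) (countDist_nonneg x)))
  have key : ∀ d : ℝ, r ^ 2 ≤ d → 1 ≤ (1 / r ^ 2) * d := fun d hd => by
    rw [one_div_mul_eq_div, one_le_div (by positivity)]
    exact hd
  unfold lyapunov
  rcases not_and_or.mp h with h | h
  · linarith [key _ (not_lt.mp h)]
  · linarith [key _ (not_lt.mp h)]

lemma lyapunov_drift {n : ℕ} {r : ℝ} (hr : 1 ≤ r) (hn : 100 * r ^ 2 < n)
    {x : Config n × Config n} (h : deviation x.1 < r ^ 2) (h' : deviation x.2 < r ^ 2)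
    (hx : 0 < countDist x) :
    ∑ y, couplingMatrix n x y * lyapunov n r y ≤ lyapunov n r x - 1 / (r ^ 2 * n) := by
  have hr0 : 0 < r := by linarith
  have hn' : (0 : ℝ) < n := lt_trans (by positivity) hn
  have hn0 : 0 < n := by exact_mod_cast hn'
  have hsqrt : 10 * r < √n := Real.lt_sqrt_of_sq_lt (by linarith)
  have hs := Real.mul_self_sqrt hn'.le
  have hrn : r * √n ≤ n / 10 := by nlinarith
  have hrn2 : 2 ≤ r * √n := by nlinarith
  have hc := abs_colorCount_sub_lt hn0 hr0 h
  have hc' := abs_colorCount_sub_lt hn0 hr0 h'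
  have hd1 := (sum_couplingMatrix_fst x deviation).trans_le (deviation_drift hn0 x.1)
  have hd2 := (sum_couplingMatrix_snd x deviation).trans_le (deviation_drift hn0 x.2)
  have hd3 := cappedParabola_drift (L := 7 * r * √n) (q := 1 / 5) hx
    (by linarith [countDist_le (fun k => (hc k).le) fun k => (hc' k).le])
    (fun i => by linarith [(abs_lt.mp (hc i)).1]) (fun i => by linarith [(abs_lt.mp (hc' i)).1])
    hn0
  have hsum : ∑ y, couplingMatrix n x y * lyapunov n r y =
      (1 / r ^ 2) * ∑ y, couplingMatrix n x y * deviation y.1 +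
      (1 / r ^ 2) * ∑ y, couplingMatrix n x y * deviation y.2 +
      15 / (4 * r ^ 2 * n) *
        ∑ y, couplingMatrix n x y * cappedParabola (7 * r * √n) (countDist y) := by
    simp only [lyapunov, mul_sum, ← sum_add_distrib]
    refine sum_congr rfl fun y _ => ?_
    ring
  rw [hsum]
  calc _ ≤ (1 / r ^ 2) * (deviation x.1 + 1 / n) + (1 / r ^ 2) * (deviation x.2 + 1 / n) +
      15 / (4 * r ^ 2 * n) *
        (cappedParabola (7 * r * √n) (countDist x) - 4 * (1 / 5)) := by gcongr
    _ = _ := by unfold lyapunov; field_simp; ring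

lemma lyapunov_le {n : ℕ} (hn : 0 < n) {r r0 : ℝ} (hr : 1 ≤ r) (hr0 : 0 < r0)
    {x : Config n × Config n} (h : inS (r0 / √n) (propVec x.1))
    (h' : inS (r0 / √n) (propVec x.2)) :
    lyapunov n r x ≤ (6 * r0 ^ 2 + 315 * r0) / r := by
  have hn' : (0 : ℝ) < n := by positivity
  have hs := Real.mul_self_sqrt hn'.le
  have hrpos : 0 < r := by linarith
  have hc := abs_colorCount_sub_le_of_inS hn h
  have hc' := abs_colorCount_sub_le_of_inS hn h'
  have hg : cappedParabola (7 * r * √n) (countDist x) ≤ 84 * r * r0 * n := by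
    calc _ ≤ 2 * (7 * r * √n) * (countDist x) :=
          cappedParabola_le (by positivity) (Int.cast_nonneg (countDist_nonneg x))
      _ ≤ 2 * (7 * r * √n) * (6 * (r0 * √n)) := by gcongr; exact countDist_le hc hc'
      _ = 84 * r * r0 * (√n * √n) := by ring
      _ = _ := by rw [hs]
  have hr2 : 1 / r ^ 2 ≤ 1 / r := one_div_le_one_div_of_le hrpos (by nlinarith)
  calc lyapunov n r x ≤ (1 / r) * (3 * r0 ^ 2) + (1 / r) * (3 * r0 ^ 2) +
        15 / (4 * r ^ 2 * n) * (84 * r * r0 * n) := by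
        unfold lyapunov
        gcongr
        · exact deviation_nonneg _
        · exact deviation_le_of_abs_le hn hc
        · exact deviation_nonneg _
        · exact deviation_le_of_abs_le hn hc'
    _ = _ := by field_simp; ring

/-- given `r₀, ε > 0` there are `γ, r > 0` such that for all large `n`
with `n > 100r²` and all starts with proportion vectors in `S^{r₀/√n}`, some Markovian
coupling makes the event
`{T₁ < γn and max(‖S_t − ē‖₂, ‖S̃_t − ē‖₂) < r/√n for all t ≤ T₁}` (with
`T₁ = min{t : ‖S_t − S̃_t‖₁ < 10/n}`) have probability at least `1 − ε`. -/
theorem coupling_l1_close_in_linear_time (r0 ε : ℝ) (hr0 : 0 < r0) (hε : 0 < ε) :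
    ∃ γ r : ℝ, 0 < γ ∧ 0 < r ∧ ∃ N : ℕ, ∀ n : ℕ, N ≤ n → 100 * r ^ 2 < (n : ℝ) →
      ∀ σ0 σ0' : Config n,
        inS (r0 / Real.sqrt n) (propVec σ0) → inS (r0 / Real.sqrt n) (propVec σ0') →
        ∃ K : Matrix (Config n × Config n) (Config n × Config n) ℝ,
          IsCoupling n (1/2) K ∧
          1 - ε ≤ pathProb K (σ0, σ0') ⌈γ * n⌉₊ (fun p =>
            ∃ u : Fin (⌈γ * n⌉₊ + 1),
              ((u : ℕ) : ℝ) < γ * n ∧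
              l1 (propVec (p u).1 - propVec (p u).2) < 10 / (n : ℝ) ∧
              (∀ t, t < u → 10 / (n : ℝ) ≤ l1 (propVec (p t).1 - propVec (p t).2)) ∧
              (∀ t, t ≤ u →
                max (l2 (fun k => propVec (p t).1 k - 1/3))
                    (l2 (fun k => propVec (p t).2 k - 1/3)) < r / Real.sqrt n)) := by
  set C := 6 * r0 ^ 2 + 315 * r0
  have hCpos : 0 < C := by positivity
  have hr1 : 1 ≤ 1 + C / ε := by linarith [div_pos hCpos hε]
  have hCr : C / (1 + C / ε) ≤ ε := by
    rw [div_le_iff₀ (by linarith), mul_add, mul_div_cancel₀ _ hε.ne']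
    linarith
  generalize 1 + C / ε = r at hr1 hCr
  have hr : 0 < r := by linarith
  refine ⟨r ^ 2, r, by positivity, hr, 0, fun n _ hn σ0 σ0' h0 h0' => ?_⟩
  have hn' : (0 : ℝ) < n := lt_trans (by positivity) hn
  have hn0 : 0 < n := by exact_mod_cast hn'
  refine ⟨couplingMatrix n, isCoupling_couplingMatrix n, ?_⟩
  have hmain := le_pathProb_hitsWithin (K := couplingMatrix n) couplingMatrix_nonneg
    (sum_couplingMatrix hn0) (G := fun x => countDist x < 10)
    (B := fun x => deviation x.1 < r ^ 2 ∧ deviation x.2 < r ^ 2)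
    (lyapunov_nonneg hr) (fun x hx => one_le_lyapunov hr hx)
    (fun x hB hG => lyapunov_drift hr1 hn hB.1 hB.2 (by omega)) ⌈r ^ 2 * n⌉₊ (σ0, σ0')
  have htime : 1 ≤ (⌈r ^ 2 * n⌉₊ : ℝ) * (1 / (r ^ 2 * n)) := by
    rw [mul_one_div, one_le_div (by positivity)]
    exact Nat.le_ceil _
  rw [min_eq_left htime] at hmain
  have hV := lyapunov_le hn0 hr1 hr0 (x := (σ0, σ0')) h0 h0'
  refine le_trans (by linarith) (hmain.trans (pathProb_mono couplingMatrix_nonneg _ _ ?_))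
  have hG : ∀ x : Config n × Config n,
      l1 (propVec x.1 - propVec x.2) < 10 / (n : ℝ) ↔ countDist x < 10 := fun x => by
    rw [l1_propVec_sub, div_lt_div_iff_of_pos_right hn']
    exact_mod_cast Iff.rfl
  rintro p - ⟨u, hu, hGu, hlt, hle⟩
  refine ⟨u, Nat.lt_ceil.mp hu, (hG _).mpr hGu, fun t ht => ?_, fun t ht => ?_⟩
  · exact not_lt.mp fun h => hlt t ht ((hG _).mp h)
  · exact max_lt ((l2_propVec_lt_iff hn0 hr _).mpr (hle t ht).1)
      ((l2_propVec_lt_iff hn0 hr _).mpr (hle t ht).2)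
end

section
/- Let B = (B_1, B_2, B_3) be a λ-partition of V_n for some λ > 0, and consider the cyclic dynamics (σ_t) with p = 1/2, its proportion chain (S_t), its basket chain (𝐒_t), and the 3×3 matrix 𝐐_t defined by 𝐐_t^{m,k} = 𝐒_t^{m,k} − S_t^k. Then there exists a constant C > 0 depending only on λ such that for all m, k ∈ {1,2,3}, all t ≥ 0 and all starting configurations σ_0, | E_{σ_0}[(𝐐^{m,k}_{t+1})²] − (1 − 1/n)·E_{σ_0}[(𝐐^{m,k}_t)²] − (1/n)·E_{σ_0}[𝐐^{m,k−1}_t 𝐐^{m,k}_t] | ≤ C/n² (color indices taken cyclically in {1,2,3}). -/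
open Finset

/-- Law of the chain at time `t` started from `σ0`. -/
noncomputable def lawAt (n : ℕ) (p : ℝ) (σ0 : Config n) (t : ℕ) : Config n → ℝ :=
  fun τ => ((cyclicP n p) ^ t) σ0 τ

/-- Expectation of `f(σ_t)` for the chain started at `σ0`. -/
noncomputable def Ex (n : ℕ) (p : ℝ) (σ0 : Config n) (t : ℕ) (f : Config n → ℝ) : ℝ :=
  ∑ τ : Config n, lawAt n p σ0 t τ * f τ

/-- `B` is a 3-partition of `V_n` into baskets. -/
def IsPartition {n : ℕ} (B : Fin 3 → Finset (Fin n)) : Prop :=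
  (∀ m m' : Fin 3, m ≠ m' → Disjoint (B m) (B m')) ∧ (∀ v : Fin n, ∃ m, v ∈ B m)

/-- Basket-chain matrix `𝐒(σ)^{m,k}`: the proportion of color-`k` vertices within
basket `B_m`. -/
noncomputable def basketS {n : ℕ} (B : Fin 3 → Finset (Fin n)) (σ : Config n)
    (m k : Fin 3) : ℝ :=
  (((B m).filter fun v => σ v = k).card : ℝ) / (B m).card

/-- `𝐐(σ)^{m,k} = 𝐒(σ)^{m,k} − S(σ)^k`. -/
noncomputable def basketQ {n : ℕ} (B : Fin 3 → Finset (Fin n)) (σ : Config n)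
    (m k : Fin 3) : ℝ :=
  basketS B σ m k - propVec σ k

/-- The operator `f ↦ E[f(σ_{t+1}) | σ_t = σ]` of the cyclic dynamics. -/
noncomputable def cyclicStep (n : ℕ) (p : ℝ) (f : Config n → ℝ) (σ : Config n) : ℝ :=
  (1 / (n : ℝ)) * ∑ v : Fin n, ((1 - p) * f σ + p * f (Function.update σ v (σ v + 1)))

theorem sum_cyclicP_mul (n : ℕ) (p : ℝ) (f : Config n → ℝ) (σ : Config n) :
    ∑ τ, cyclicP n p σ τ * f τ = cyclicStep n p f σ := by
  simp only [cyclicP, cyclicStep, Matrix.of_apply, mul_assoc, ← Finset.mul_sum, Finset.sum_mul]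
  rw [Finset.sum_comm]
  simp [add_mul, Finset.sum_add_distrib, ← Finset.mul_sum]

theorem Ex_zero (n : ℕ) (p : ℝ) (σ0 : Config n) (f : Config n → ℝ) :
    Ex n p σ0 0 f = f σ0 := by
  simp [Ex, lawAt, Matrix.one_apply]

theorem Ex_succ (n : ℕ) (p : ℝ) (σ0 : Config n) (t : ℕ) (f : Config n → ℝ) :
    Ex n p σ0 (t + 1) f = Ex n p σ0 t (cyclicStep n p f) := by
  simp only [Ex, lawAt, pow_succ, Matrix.mul_apply, Finset.sum_mul, ← sum_cyclicP_mul,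
    Finset.mul_sum, mul_assoc]
  exact Finset.sum_comm

theorem cyclicStep_const {n : ℕ} (hn : n ≠ 0) (p c : ℝ) :
    cyclicStep n p (fun _ => c) = fun _ => c := by
  have : (n : ℝ) ≠ 0 := by exact_mod_cast hn
  funext σ
  simp only [cyclicStep, Finset.sum_const, Finset.card_univ, Fintype.card_fin, nsmul_eq_mul]
  field_simp
  ring

theorem Ex_const {n : ℕ} (hn : n ≠ 0) (p c : ℝ) (σ0 : Config n) (t : ℕ) :
    Ex n p σ0 t (fun _ => c) = c := by
  induction t with
  | zero => exact Ex_zero ..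
  | succ t ih => rw [Ex_succ, cyclicStep_const hn, ih]

theorem cyclicStep_mono {n : ℕ} {p : ℝ} (hp0 : 0 ≤ p) (hp1 : p ≤ 1) {f g : Config n → ℝ}
    (h : ∀ σ, f σ ≤ g σ) (σ : Config n) : cyclicStep n p f σ ≤ cyclicStep n p g σ := by
  have := sub_nonneg.2 hp1
  unfold cyclicStep
  gcongr <;> apply h

theorem Ex_mono {n : ℕ} {p : ℝ} (hp0 : 0 ≤ p) (hp1 : p ≤ 1) (σ0 : Config n) (t : ℕ)
    {f g : Config n → ℝ} (h : ∀ σ, f σ ≤ g σ) : Ex n p σ0 t f ≤ Ex n p σ0 t g := by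
  induction t generalizing f g with
  | zero => simpa only [Ex_zero] using h σ0
  | succ t ih =>
    rw [Ex_succ, Ex_succ]
    exact ih (cyclicStep_mono hp0 hp1 h)

/-- The weight of the vertex `v` in `𝐐^{m,k}`, viewed as a linear statistic of the colors. -/
noncomputable def basketWeight {n : ℕ} (B : Fin 3 → Finset (Fin n)) (m : Fin 3) (v : Fin n) : ℝ :=
  (if v ∈ B m then 1 / ((B m).card : ℝ) else 0) - 1 / n

theorem basketQ_eq_sum {n : ℕ} (B : Fin 3 → Finset (Fin n)) (σ : Config n) (m k : Fin 3) :
    basketQ B σ m k = ∑ v, basketWeight B m v * (if σ v = k then 1 else 0) := by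
  simp only [basketQ, basketS, propVec, basketWeight, sub_mul, Finset.sum_sub_distrib,
    Finset.card_filter, Nat.cast_sum, Finset.sum_div]
  congr 1
  · simp only [ite_mul, zero_mul, Finset.sum_ite_mem, Finset.univ_inter]
    refine Finset.sum_congr rfl fun v _ => ?_
    split_ifs <;> simp
  · refine Finset.sum_congr rfl fun v _ => ?_
    split_ifs <;> simp

theorem basketQ_update {n : ℕ} (B : Fin 3 → Finset (Fin n)) (σ : Config n) (m k : Fin 3)
    (v : Fin n) :
    basketQ B (Function.update σ v (σ v + 1)) m k = basketQ B σ m k +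
      basketWeight B m v * ((if σ v = k - 1 then 1 else 0) - (if σ v = k then 1 else 0)) := by
  rw [basketQ_eq_sum, basketQ_eq_sum, ← sub_eq_iff_eq_add', ← Finset.sum_sub_distrib,
    Finset.sum_eq_single v]
  · simp [mul_sub, eq_sub_iff_add_eq]
  · intro u _ hu
    simp [Function.update_of_ne hu]
  · simp

theorem abs_basketWeight_le {n : ℕ} (hn : 0 < n) {lam : ℝ} (hlam : 0 < lam)
    (B : Fin 3 → Finset (Fin n)) (m : Fin 3) (hB : lam * n < ((B m).card : ℝ)) (v : Fin n) :
    |basketWeight B m v| ≤ (1 / lam + 1) / n := by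
  have hn' : (0 : ℝ) < n := by exact_mod_cast hn
  have hinv : 1 / ((B m).card : ℝ) ≤ 1 / lam / n := by
    rw [div_div]
    exact one_div_le_one_div_of_le (by positivity) hB.le
  have hcard : 0 ≤ 1 / ((B m).card : ℝ) := by positivity
  have hlam' : 0 ≤ 1 / lam / n := by positivity
  have hone : 0 ≤ 1 / (n : ℝ) := by positivity
  rw [basketWeight, add_div, abs_le]
  split_ifs <;> constructor <;> linarith

theorem cyclicStep_basketQ_sq {n : ℕ} (hn : n ≠ 0) (B : Fin 3 → Finset (Fin n)) (m k : Fin 3)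
    (σ : Config n) :
    cyclicStep n (1 / 2) (fun τ => basketQ B τ m k ^ 2) σ =
      (1 - 1 / (n : ℝ)) * basketQ B σ m k ^ 2
        + (1 / (n : ℝ)) * (basketQ B σ m (k - 1) * basketQ B σ m k)
        + 1 / (2 * n) * ∑ v, (basketWeight B m v *
          ((if σ v = k - 1 then 1 else 0) - (if σ v = k then 1 else 0))) ^ 2 := by
  have hn' : (n : ℝ) ≠ 0 := by exact_mod_cast hn
  have hdrift : ∑ v, basketWeight B m v *
      ((if σ v = k - 1 then 1 else 0) - (if σ v = k then 1 else 0)) =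
      basketQ B σ m (k - 1) - basketQ B σ m k := by
    simp only [basketQ_eq_sum, mul_sub, Finset.sum_sub_distrib]
  simp only [cyclicStep, basketQ_update]
  set q := basketQ B σ m k
  set d : Fin n → ℝ := fun v => basketWeight B m v *
    ((if σ v = k - 1 then 1 else 0) - (if σ v = k then 1 else 0))
  have hexpand : ∀ v, (1 - 1 / 2) * q ^ 2 + 1 / 2 * (q + d v) ^ 2 =
      q ^ 2 + q * d v + 1 / 2 * d v ^ 2 := fun v => by ring
  change 1 / (n : ℝ) * ∑ v, ((1 - 1 / 2) * q ^ 2 + 1 / 2 * (q + d v) ^ 2) =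
    (1 - 1 / (n : ℝ)) * q ^ 2 + (1 / (n : ℝ)) * (basketQ B σ m (k - 1) * q)
      + 1 / (2 * n) * ∑ v, d v ^ 2
  change ∑ v, d v = _ at hdrift
  clear_value d
  simp only [hexpand, Finset.sum_add_distrib, ← Finset.mul_sum, hdrift, Finset.sum_const,
    Finset.card_univ, Fintype.card_fin, nsmul_eq_mul]
  field_simp
  ring

theorem sum_sq_increment_le {n : ℕ} (hn : 0 < n) {lam : ℝ} (hlam : 0 < lam)
    (B : Fin 3 → Finset (Fin n)) (m k : Fin 3) (hB : lam * n < ((B m).card : ℝ)) (σ : Config n) :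
    1 / (2 * (n : ℝ)) * ∑ v, (basketWeight B m v *
      ((if σ v = k - 1 then 1 else 0) - (if σ v = k then 1 else 0))) ^ 2 ≤
      (1 / lam + 1) ^ 2 / (n : ℝ) ^ 2 := by
  have hn' : (0 : ℝ) < n := by exact_mod_cast hn
  have hterm : ∀ v ∈ (univ : Finset (Fin n)), (basketWeight B m v *
      ((if σ v = k - 1 then 1 else 0) - (if σ v = k then 1 else 0))) ^ 2 ≤
      ((1 / lam + 1) / n) ^ 2 := fun v _ => by
    rw [sq_le_sq, abs_mul, abs_of_nonneg (a := (1 / lam + 1) / n) (by positivity)]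
    refine (mul_le_of_le_one_right (abs_nonneg _) ?_).trans
      (abs_basketWeight_le hn hlam B m hB v)
    split_ifs <;> norm_num
  have hsum := Finset.sum_le_card_nsmul _ _ _ hterm
  rw [Finset.card_univ, Fintype.card_fin, nsmul_eq_mul] at hsum
  calc _ ≤ 1 / (2 * (n : ℝ)) * (n * ((1 / lam + 1) / n) ^ 2) := by gcongr
    _ = 1 / 2 * ((1 / lam + 1) ^ 2 / (n : ℝ) ^ 2) := by field_simp
    _ ≤ _ := mul_le_of_le_one_left (by positivity) (by norm_num)

/-- one-step identity for the second moments of `𝐐_t`, with an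
error `O(1/n²)` whose constant depends only on `λ`. Indices are cyclic in `Fin 3`. -/
theorem basket_chain_contraction_identity (lam : ℝ) (hlam : 0 < lam) :
    ∃ C : ℝ, 0 < C ∧ ∀ n : ℕ, ∀ B : Fin 3 → Finset (Fin n),
      IsPartition B → (∀ m : Fin 3, lam * n < ((B m).card : ℝ)) →
      ∀ (m k : Fin 3) (t : ℕ) (σ0 : Config n),
        |Ex n (1/2) σ0 (t+1) (fun τ => (basketQ B τ m k) ^ 2)
            - (1 - 1 / (n : ℝ)) * Ex n (1/2) σ0 t (fun τ => (basketQ B τ m k) ^ 2)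
            - (1 / (n : ℝ)) * Ex n (1/2) σ0 t (fun τ => basketQ B τ m (k - 1) * basketQ B τ m k)|
          ≤ C / (n : ℝ) ^ 2 := by
  refine ⟨(1 / lam + 1) ^ 2, by positivity, fun n B _ hB m k t σ0 => ?_⟩
  have hn : 0 < n := by
    rcases Nat.eq_zero_or_pos n with rfl | hn
    · have hcard : (B m).card ≤ 0 := by simpa using (B m).card_le_univ
      have := hB m
      simp [Nat.le_zero.1 hcard] at this
    · exact hn
  set err : Config n → ℝ := fun σ => 1 / (2 * (n : ℝ)) * ∑ v, (basketWeight B m v *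
    ((if σ v = k - 1 then 1 else 0) - (if σ v = k then 1 else 0))) ^ 2 with herr
  have hEx : Ex n (1/2) σ0 (t+1) (fun τ => (basketQ B τ m k) ^ 2)
      - (1 - 1 / (n : ℝ)) * Ex n (1/2) σ0 t (fun τ => (basketQ B τ m k) ^ 2)
      - (1 / (n : ℝ)) * Ex n (1/2) σ0 t (fun τ => basketQ B τ m (k - 1) * basketQ B τ m k)
      = Ex n (1/2) σ0 t err := by
    rw [Ex_succ, funext (cyclicStep_basketQ_sq hn.ne' B m k)]
    simp only [Ex, Finset.mul_sum, ← Finset.sum_sub_distrib]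
    refine Finset.sum_congr rfl fun τ _ => ?_
    simp only [herr, ← Finset.mul_sum]
    ring
  have hnonneg : 0 ≤ Ex n (1/2) σ0 t err := by
    rw [← Ex_const hn.ne' (1/2) 0 σ0 t]
    exact Ex_mono (by norm_num) (by norm_num) σ0 t fun σ => by positivity
  rw [hEx, abs_of_nonneg hnonneg, ← Ex_const hn.ne' (1/2) ((1 / lam + 1) ^ 2 / (n : ℝ) ^ 2) σ0 t]
  exact Ex_mono (by norm_num) (by norm_num) σ0 t (sum_sq_increment_le hn hlam B m k (hB m))
end

section
/- Upper bound for the cutoff of the cyclic dynamics with p = 1/2: for every ε > 0 there exists γ > 0 such that for all sufficiently large n and every starting configuration σ_0 ∈ Σ_n, the total variation distance between the law of σ at time t_γ(n) = ⌈(2/3) n log n + γ n⌉ started from σ_0 and the uniform measure μ_n satisfies ‖ℙ_{σ_0}(σ_{t_γ(n)} ∈ ·) − μ_n‖_TV ≤ ε. -/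
open Finset

/-- Total variation distance `max_{A ⊆ X} |μ(A) - ν(A)|` on a finite space. -/
noncomputable def tvDist {X : Type*} [Fintype X] (μ ν : X → ℝ) : ℝ :=
  ⨆ A : Finset X, |∑ x ∈ A, μ x - ∑ x ∈ A, ν x|

/-- Uniform measure `μ_n` on `Σ_n`. -/
noncomputable def unif (n : ℕ) : Config n → ℝ := fun _ => 1 / 3 ^ n

/-- The primitive cube root of unity `exp (2πi/3)`. -/
noncomputable def cubeRoot : ℂ := ⟨-1 / 2, Real.sqrt 3 / 2⟩

lemma cubeRoot_sq : cubeRoot ^ 2 = -1 - cubeRoot := by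
  have h : Real.sqrt 3 * Real.sqrt 3 = 3 := Real.mul_self_sqrt (by norm_num)
  apply Complex.ext <;> simp [cubeRoot, pow_two] <;> linarith

lemma conj_cubeRoot : (starRingEnd ℂ) cubeRoot = -1 - cubeRoot := by
  apply Complex.ext
  · simp [cubeRoot]
    norm_num
  · simp [cubeRoot]

/-- The characters of `ℤ/3`, indexed by their frequency `a`. -/
noncomputable def colorChar (a b : Fin 3) : ℂ := cubeRoot ^ (a.val * b.val)

lemma colorChar_add_one (a b : Fin 3) :
    colorChar a (b + 1) = colorChar a 1 * colorChar a b := by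
  have h := cubeRoot_sq
  fin_cases a <;> fin_cases b <;> simp [colorChar] <;> grind

lemma sum_colorChar_mul_conj (b c : Fin 3) :
    ∑ a, colorChar a b * (starRingEnd ℂ) (colorChar a c) = if b = c then 3 else 0 := by
  have h := cubeRoot_sq
  fin_cases b <;> fin_cases c <;>
    simp [colorChar, Fin.sum_univ_three, conj_cubeRoot] <;> grind

/-- The characters of `(ℤ/3)^n`. -/
noncomputable def configChar {n : ℕ} (χ σ : Config n) : ℂ := ∏ v, colorChar (χ v) (σ v)

lemma configChar_zero {n : ℕ} (σ : Config n) : configChar 0 σ = 1 := by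
  simp [configChar, colorChar]

lemma norm_cubeRoot : ‖cubeRoot‖ = 1 := by
  have h : ‖cubeRoot‖ ^ 2 = 1 := by
    rw [← Complex.normSq_eq_norm_sq, Complex.normSq_apply]
    have h : Real.sqrt 3 * Real.sqrt 3 = 3 := Real.mul_self_sqrt (by norm_num)
    simp only [cubeRoot]
    linarith
  exact (pow_eq_one_iff_of_nonneg (norm_nonneg _) two_ne_zero).1 h

lemma norm_configChar {n : ℕ} (χ σ : Config n) : ‖configChar χ σ‖ = 1 := by
  simp [configChar, colorChar, norm_cubeRoot]

lemma configChar_update {n : ℕ} (χ σ : Config n) (v : Fin n) :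
    configChar χ (Function.update σ v (σ v + 1)) = colorChar (χ v) 1 * configChar χ σ := by
  unfold configChar
  rw [← Finset.mul_prod_erase _ _ (Finset.mem_univ v),
    ← Finset.mul_prod_erase univ (fun v => colorChar (χ v) (σ v)) (Finset.mem_univ v)]
  rw [Function.update_self, colorChar_add_one, mul_assoc]
  congr 2
  refine Finset.prod_congr rfl fun w hw => ?_
  rw [Function.update_of_ne (Finset.ne_of_mem_erase hw)]

lemma sum_configChar_mul_conj {n : ℕ} (σ τ : Config n) :
    ∑ χ, configChar χ σ * (starRingEnd ℂ) (configChar χ τ) = if σ = τ then 3 ^ n else 0 := by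
  have h : ∀ χ : Config n, configChar χ σ * (starRingEnd ℂ) (configChar χ τ) =
      ∏ v, colorChar (χ v) (σ v) * (starRingEnd ℂ) (colorChar (χ v) (τ v)) := by
    intro χ
    simp [configChar, Finset.prod_mul_distrib, map_prod]
  simp_rw [h]
  rw [← Fintype.prod_sum fun v a => colorChar a (σ v) * (starRingEnd ℂ) (colorChar a (τ v))]
  simp_rw [sum_colorChar_mul_conj]
  split_ifs with hστ
  · simp [hστ]
  · obtain ⟨v, hv⟩ := Function.ne_iff.1 hστ
    exact Finset.prod_eq_zero (Finset.mem_univ v) (by simp [hv])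

/-- Parseval's identity on `(ℤ/3)^n`. -/
lemma sum_norm_sq_fourier {n : ℕ} (g : Config n → ℝ) :
    ∑ χ, ‖∑ τ, (g τ : ℂ) * configChar χ τ‖ ^ 2 = 3 ^ n * ∑ τ, g τ ^ 2 := by
  have h : ((∑ χ, ‖∑ τ, (g τ : ℂ) * configChar χ τ‖ ^ 2 : ℝ) : ℂ) =
      ((3 ^ n * ∑ τ, g τ ^ 2 : ℝ) : ℂ) := by
    push_cast
    simp_rw [← Complex.mul_conj', map_sum, Finset.sum_mul_sum, map_mul, Complex.conj_ofReal]
    rw [Finset.sum_comm, Finset.mul_sum]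
    refine Finset.sum_congr rfl fun σ _ => ?_
    rw [Finset.sum_comm]
    have h' : ∀ τ : Config n, ∑ χ, (g σ : ℂ) * configChar χ σ *
        ((g τ : ℂ) * (starRingEnd ℂ) (configChar χ τ)) =
        g σ * g τ * if σ = τ then 3 ^ n else 0 := by
      intro τ
      rw [← sum_configChar_mul_conj, Finset.mul_sum]
      exact Finset.sum_congr rfl fun χ _ => by ring
    simp_rw [h']
    simp
    ring
  exact_mod_cast h

/-- The eigenvalue of the lazy (`p = 1/2`) cyclic dynamics on the character `χ`. -/
noncomputable def cyclicEigenvalue {n : ℕ} (χ : Config n) : ℂ :=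
  (1 / (n : ℂ)) * ∑ v, (1 + colorChar (χ v) 1) / 2

lemma sum_cyclicP_mul_configChar {n : ℕ} (χ σ : Config n) :
    ∑ τ, (cyclicP n (1 / 2) σ τ : ℂ) * configChar χ τ =
      cyclicEigenvalue χ * configChar χ σ := by
  simp only [cyclicP, Matrix.of_apply, cyclicEigenvalue]
  push_cast
  simp_rw [mul_assoc, Finset.sum_mul, ← Finset.mul_sum]
  rw [Finset.sum_comm]
  congr 1
  refine Finset.sum_congr rfl fun v _ => ?_
  simp_rw [add_mul, Finset.sum_add_distrib, mul_assoc, ← Finset.mul_sum]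
  simp only [apply_ite (Complex.ofReal), Complex.ofReal_one, Complex.ofReal_zero, ite_mul, one_mul,
    zero_mul, Finset.sum_ite_eq', Finset.mem_univ, if_true, configChar_update]
  ring

lemma sum_lawAt_mul_configChar {n : ℕ} (χ σ : Config n) (t : ℕ) :
    ∑ τ, (lawAt n (1 / 2) σ t τ : ℂ) * configChar χ τ =
      cyclicEigenvalue χ ^ t * configChar χ σ := by
  unfold lawAt
  induction t generalizing σ with
  | zero => simp [Matrix.one_apply, apply_ite (Complex.ofReal)]
  | succ t ih =>
    simp_rw [pow_succ', Matrix.mul_apply]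
    push_cast
    simp_rw [Finset.sum_mul]
    rw [Finset.sum_comm]
    simp_rw [mul_assoc, ← Finset.mul_sum, ih, mul_left_comm _ (cyclicEigenvalue χ ^ t),
      ← Finset.mul_sum, sum_cyclicP_mul_configChar]

lemma cyclicEigenvalue_zero {n : ℕ} (hn : 1 ≤ n) : cyclicEigenvalue (0 : Config n) = 1 := by
  have : (n : ℂ) ≠ 0 := by exact_mod_cast (by omega : n ≠ 0)
  simp [cyclicEigenvalue, colorChar, this]

/-- The number of sites where `χ` does not vanish. -/
def supportCard {n : ℕ} (χ : Config n) : ℕ := #{v | χ v ≠ 0}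

lemma norm_sq_cyclicEigenvalue_le {n : ℕ} (hn : 1 ≤ n) (χ : Config n) :
    ‖cyclicEigenvalue χ‖ ^ 2 ≤
      1 - (3 / 2 * (supportCard χ / n : ℝ) - 3 / 4 * (supportCard χ / n : ℝ) ^ 2) := by
  have hn0 : (n : ℝ) ≠ 0 := by exact_mod_cast (by omega : n ≠ 0)
  have hs : ∑ v, (if χ v ≠ 0 then (1 : ℝ) else 0) = supportCard χ := by
    rw [Finset.sum_boole, supportCard]
  set k : ℝ := (supportCard χ : ℝ)
  have hre : (∑ v, (1 + colorChar (χ v) 1) / 2).re = n - 3 / 4 * k := by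
    rw [← hs, Complex.re_sum, Finset.mul_sum]
    have : (n : ℝ) = ∑ v : Fin n, 1 := by simp
    rw [this, ← Finset.sum_sub_distrib]
    refine Finset.sum_congr rfl fun v _ => ?_
    generalize χ v = a
    fin_cases a <;> simp [colorChar, cubeRoot_sq] <;> simp [cubeRoot] <;> norm_num
  have him : |(∑ v, (1 + colorChar (χ v) 1) / 2).im| ≤ Real.sqrt 3 / 4 * k := by
    rw [← hs, Complex.im_sum, Finset.mul_sum]
    refine (Finset.abs_sum_le_sum_abs _ _).trans (Finset.sum_le_sum fun v _ => ?_)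
    generalize χ v = a
    have h3 : 0 ≤ Real.sqrt 3 := Real.sqrt_nonneg 3
    fin_cases a <;> simp [colorChar, cubeRoot_sq] <;> simp [cubeRoot, abs_le] <;>
      (try constructor) <;> linarith
  have him2 : (∑ v, (1 + colorChar (χ v) 1) / 2).im ^ 2 ≤ 3 / 16 * k ^ 2 := by
    have := sq_le_sq' (abs_le.1 him).1 (abs_le.1 him).2
    rw [mul_pow, div_pow, Real.sq_sqrt (by norm_num)] at this
    linarith
  rw [cyclicEigenvalue, norm_mul, mul_pow, ← Complex.normSq_eq_norm_sq (∑ v, _),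
    Complex.normSq_apply, hre, ← sq (Complex.im _)]
  simp only [one_div, norm_inv, Complex.norm_natCast]
  have : 1 - (3 / 2 * (k / n) - 3 / 4 * (k / n) ^ 2) =
      (n : ℝ)⁻¹ ^ 2 * ((n - 3 / 4 * k) * (n - 3 / 4 * k) + 3 / 16 * k ^ 2) := by
    field_simp
    ring
  rw [this]
  gcongr

lemma card_filter_support_eq {n : ℕ} (S : Finset (Fin n)) :
    #{χ : Config n | ({v | χ v ≠ 0} : Finset (Fin n)) = S} = 2 ^ #S := by
  have : ({χ : Config n | ({v | χ v ≠ 0} : Finset (Fin n)) = S} : Finset (Config n)) =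
      Fintype.piFinset fun v => if v ∈ S then ({1, 2} : Finset (Fin 3)) else {0} := by
    ext χ
    simp only [Finset.mem_filter, Finset.mem_univ, true_and, Fintype.mem_piFinset,
      Finset.ext_iff]
    refine forall_congr' fun v => ?_
    generalize χ v = a
    by_cases hv : v ∈ S <;> simp only [hv, if_true, if_false] <;> revert a <;> decide
  rw [this, Fintype.card_piFinset]
  simp only [apply_ite Finset.card]
  simp

lemma sum_supportCard {n : ℕ} (f : ℕ → ℝ) :
    ∑ χ : Config n, f (supportCard χ) =
      ∑ k ∈ range (n + 1), (n.choose k : ℝ) * (2 ^ k * f k) := by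
  have h := Finset.sum_powerset_apply_card (fun k => (2 : ℝ) ^ k * f k)
    (x := (univ : Finset (Fin n)))
  simp only [Finset.card_univ, Fintype.card_fin, nsmul_eq_mul] at h
  rw [← h, ← Finset.sum_fiberwise_of_maps_to (s := univ) (t := (univ : Finset (Fin n)).powerset)
    (g := fun χ : Config n => ({v | χ v ≠ 0} : Finset (Fin n))) (by simp)]
  refine Finset.sum_congr rfl fun S _ => ?_
  rw [Finset.sum_congr rfl (g := fun _ => f #S), Finset.sum_const, card_filter_support_eq]
  · simp
  · intro χ hχ
    rw [supportCard, (Finset.mem_filter.1 hχ).2]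

lemma div_mul_log_le {n k : ℝ} (hk1 : 1 ≤ k) (hkn : k ≤ n) :
    k / n * Real.log n ≤ 1 + Real.log k := by
  have hk : 0 < k := by linarith
  have hn : 0 < n := by linarith
  have h1 : Real.log (n / k) ≤ n / k := (Real.log_le_sub_one_of_pos (by positivity)).trans
    (by linarith)
  rw [Real.log_div hn.ne' hk.ne'] at h1
  have h2 : k / n * (Real.log n - Real.log k) ≤ 1 := by
    calc k / n * (Real.log n - Real.log k) ≤ k / n * (n / k) := by gcongr
      _ = 1 := by field_simp
  have h3 : k / n * Real.log k ≤ 1 * Real.log k :=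
    mul_le_mul_of_nonneg_right ((div_le_one hn).2 hkn) (Real.log_nonneg hk1)
  linarith

lemma choose_mul_exp_le {n k : ℕ} (hk : 1 ≤ k) (hkn : k ≤ n) {γ t : ℝ} (hγ : 0 ≤ γ)
    (ht : 2 / 3 * n * Real.log n + γ * n ≤ t) :
    (n.choose k : ℝ) * (2 ^ k *
      Real.exp (-(3 / 2 * (k / n : ℝ) - 3 / 4 * (k / n : ℝ) ^ 2) * t)) ≤
      Real.exp (Real.log 2 + 2 - 3 / 4 * γ) ^ k := by
  have hk0 : (1 : ℝ) ≤ k := by exact_mod_cast hk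
  have hkn' : (k : ℝ) ≤ n := by exact_mod_cast hkn
  have hkpos : (0 : ℝ) < k := by linarith
  have hn0 : (0 : ℝ) < n := by linarith
  have hlogk : 0 ≤ Real.log k := Real.log_nonneg hk0
  have hlog := div_mul_log_le hk0 hkn'
  have hx1 : (k / n : ℝ) ≤ 1 := (div_le_one hn0).2 hkn'
  have hx0 : (0 : ℝ) ≤ k / n := by positivity
  have hexp : -(3 / 2 * (k / n : ℝ) - 3 / 4 * (k / n : ℝ) ^ 2) * t ≤
      k * (1 + Real.log k - Real.log n - 3 / 4 * γ) := by
    have hy : 0 ≤ 3 / 2 * (k / n : ℝ) - 3 / 4 * (k / n : ℝ) ^ 2 := by nlinarith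
    have h1 := mul_le_mul_of_nonneg_left ht hy
    have h2 : (3 / 2 * (k / n : ℝ) - 3 / 4 * (k / n : ℝ) ^ 2) *
        (2 / 3 * n * Real.log n + γ * n) =
        k * (Real.log n - 1 / 2 * (k / n * Real.log n) + γ * (3 / 2 - 3 / 4 * (k / n))) := by
      field_simp
      ring
    have h3 : k * (Real.log n - (1 + Real.log k) + 3 / 4 * γ) ≤
        k * (Real.log n - 1 / 2 * (k / n * Real.log n) + γ * (3 / 2 - 3 / 4 * (k / n))) := by
      have : γ * (3 / 4) ≤ γ * (3 / 2 - 3 / 4 * (k / n)) := by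
        gcongr
        linarith
      gcongr ?_ * ?_
      linarith
    linarith
  have hchoose : (n.choose k : ℝ) ≤ n ^ k / k.factorial := Nat.choose_le_pow_div k n
  have hfact : (k : ℝ) ^ k / k.factorial ≤ Real.exp k := Real.pow_div_factorial_le_exp k hkpos.le k
  have hsplit : Real.exp (k * (1 + Real.log k - Real.log n - 3 / 4 * γ)) =
      Real.exp (1 - 3 / 4 * γ) ^ k * (k : ℝ) ^ k / n ^ k := by
    rw [Real.exp_nat_mul, ← mul_pow, ← div_pow]
    congr 1
    rw [show 1 + Real.log k - Real.log n - 3 / 4 * γ =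
      (1 - 3 / 4 * γ) + Real.log k - Real.log n by ring, Real.exp_sub, Real.exp_add,
      Real.exp_log hkpos, Real.exp_log hn0]
  calc (n.choose k : ℝ) * (2 ^ k *
        Real.exp (-(3 / 2 * (k / n : ℝ) - 3 / 4 * (k / n : ℝ) ^ 2) * t))
      ≤ n ^ k / k.factorial * (2 ^ k *
        (Real.exp (1 - 3 / 4 * γ) ^ k * (k : ℝ) ^ k / n ^ k)) := by
        rw [← hsplit]
        gcongr
    _ = 2 ^ k * Real.exp (1 - 3 / 4 * γ) ^ k * ((k : ℝ) ^ k / k.factorial) := by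
        field_simp
    _ ≤ 2 ^ k * Real.exp (1 - 3 / 4 * γ) ^ k * Real.exp k := by gcongr
    _ = Real.exp (Real.log 2 + 2 - 3 / 4 * γ) ^ k := by
        rw [← mul_one (k : ℝ), Real.exp_nat_mul, ← mul_pow, ← mul_pow]
        congr 1
        rw [show Real.log 2 + 2 - 3 / 4 * γ = Real.log 2 + (1 - 3 / 4 * γ) + 1 by ring,
          Real.exp_add, Real.exp_add, Real.exp_log (by norm_num)]

/-- The `ℓ²` distance of the law to equilibrium, in terms of the eigenvalues. -/
lemma sum_sq_lawAt_sub_unif {n : ℕ} (hn : 1 ≤ n) (σ : Config n) (t : ℕ) :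
    3 ^ n * ∑ τ, (lawAt n (1 / 2) σ t τ - unif n τ) ^ 2 =
      (∑ χ : Config n, (‖cyclicEigenvalue χ‖ ^ 2) ^ t) - 1 := by
  have h1 := sum_norm_sq_fourier (lawAt n (1 / 2) σ t)
  simp_rw [sum_lawAt_mul_configChar, norm_mul, norm_configChar, mul_one, norm_pow,
    fun χ : Config n => pow_right_comm ‖cyclicEigenvalue χ‖ t 2] at h1
  have h2 : ∑ τ, lawAt n (1 / 2) σ t τ = 1 := by
    have := sum_lawAt_mul_configChar 0 σ t
    simp only [configChar_zero, cyclicEigenvalue_zero hn, mul_one, one_pow] at this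
    exact_mod_cast this
  rw [h1]
  simp_rw [sub_sq, Finset.sum_add_distrib, Finset.sum_sub_distrib, unif]
  rw [← Finset.sum_mul, ← Finset.mul_sum, h2]
  simp
  field_simp
  ring

lemma tvDist_unif_le {n : ℕ} (μ : Config n → ℝ) {ε : ℝ} (hε : 0 ≤ ε)
    (h : 3 ^ n * ∑ τ, (μ τ - unif n τ) ^ 2 ≤ ε ^ 2) : tvDist μ (unif n) ≤ ε := by
  refine ciSup_le fun A => abs_le_of_sq_le_sq ?_ hε
  rw [← Finset.sum_sub_distrib]
  refine (sq_sum_le_card_mul_sum_sq).trans (le_trans ?_ h)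
  have hA : (#A : ℝ) ≤ 3 ^ n := by
    have := Finset.card_le_univ A
    rw [Fintype.card_pi_const, Fintype.card_fin] at this
    exact_mod_cast this
  gcongr
  exact Finset.subset_univ A

lemma sum_norm_cyclicEigenvalue_le {n : ℕ} (hn : 1 ≤ n) {γ : ℝ} (hγ : 0 ≤ γ) {t : ℕ}
    (ht : 2 / 3 * n * Real.log n + γ * n ≤ t) :
    ∑ χ : Config n, (‖cyclicEigenvalue χ‖ ^ 2) ^ t ≤
      ∑ k ∈ range (n + 1), Real.exp (Real.log 2 + 2 - 3 / 4 * γ) ^ k := by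
  have h : ∀ χ : Config n, (‖cyclicEigenvalue χ‖ ^ 2) ^ t ≤
      Real.exp (-(3 / 2 * (supportCard χ / n : ℝ) -
        3 / 4 * (supportCard χ / n : ℝ) ^ 2) * t) := by
    intro χ
    rw [mul_comm, Real.exp_nat_mul]
    gcongr
    exact (norm_sq_cyclicEigenvalue_le hn χ).trans (Real.one_sub_le_exp_neg _)
  refine (Finset.sum_le_sum fun χ _ => h χ).trans ?_
  rw [sum_supportCard fun k : ℕ =>
    Real.exp (-(3 / 2 * (k / n : ℝ) - 3 / 4 * (k / n : ℝ) ^ 2) * t)]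
  refine Finset.sum_le_sum fun k hk => ?_
  rcases Nat.eq_zero_or_pos k with rfl | hk0
  · simp
  · exact choose_mul_exp_le hk0 (Nat.lt_succ_iff.1 (Finset.mem_range.1 hk)) hγ ht

lemma geom_sum_sub_one_le {r : ℝ} (h0 : 0 ≤ r) (h1 : r ≤ 1 / 2) (n : ℕ) :
    ∑ k ∈ range (n + 1), r ^ k - 1 ≤ 2 * r := by
  have h : ∑ k ∈ range n, r ^ k ≤ 2 := by
    have h2 := geom_sum_mul_neg r n
    have h3 : 0 ≤ r ^ n := by positivity
    have h4 : 0 ≤ ∑ k ∈ range n, r ^ k := Finset.sum_nonneg fun k _ => by positivity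
    nlinarith
  rw [Finset.sum_range_succ']
  simp_rw [pow_succ, ← Finset.sum_mul]
  simp only [pow_zero, add_sub_cancel_right]
  gcongr

/-- upper bound for the cutoff of the cyclic dynamics with `p = 1/2`:
for every `ε > 0` there is `γ > 0` such that for all large `n` and every start `σ0`,
the chain at time `t_γ(n) = ⌈(2/3) n log n + γ n⌉` is within total variation `ε`
of the uniform measure. -/
theorem cyclic_dynamics_upper_bound (ε : ℝ) (hε : 0 < ε) :
    ∃ γ : ℝ, 0 < γ ∧ ∃ N : ℕ, ∀ n : ℕ, N ≤ n → ∀ σ0 : Config n,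
      tvDist (lawAt n (1/2) σ0 ⌈(2/3) * n * Real.log n + γ * n⌉₊) (unif n) ≤ ε := by
  set r : ℝ := min (1 / 2) (ε ^ 2 / 2)
  have hr0 : 0 < r := lt_min (by norm_num) (by positivity)
  have hr1 : r ≤ 1 / 2 := min_le_left _ _
  have hr2 : r ≤ ε ^ 2 / 2 := min_le_right _ _
  have hlogr : Real.log r < 0 := Real.log_neg hr0 (by linarith)
  have hlog2 : 0 < Real.log 2 := Real.log_pos (by norm_num)
  have hγ : 0 < 4 / 3 * (Real.log 2 + 2 - Real.log r) := by linarith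
  refine ⟨4 / 3 * (Real.log 2 + 2 - Real.log r), hγ, 1, fun n hn σ0 => ?_⟩
  refine tvDist_unif_le _ hε.le ?_
  rw [sum_sq_lawAt_sub_unif hn]
  have h := sum_norm_cyclicEigenvalue_le hn hγ.le (Nat.le_ceil _)
  rw [show Real.log 2 + 2 - 3 / 4 * (4 / 3 * (Real.log 2 + 2 - Real.log r)) = Real.log r by ring,
    Real.exp_log hr0] at h
  linarith [geom_sum_sub_one_le hr0.le hr1 n]
end
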